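/- Let M be a 0,1 matrix with real rank at most d. Then M has at most 2^d distinct rows and at most 2^d distinct columns. -/

import Mathlib

/-- The columns of a matrix over a field are determined by their restrictions to `M.rank` many
suitably chosen rows. -/
theorem exists_rows_determining_cols {K : Type*} [Field K] {n m : ℕ}
    (M : Matrix (Fin n) (Fin m) K) :
    ∃ g : Fin M.rank → Fin n, ∀ j j' : Fin m,
      (∀ k, M (g k) j = M (g k) j') → ∀ i, M i j = M i j' := by
  rw [M.rank_eq_finrank_span_row]
  obtain ⟨f, hf, hspan, -⟩ := Submodule.exists_fun_fin_finrank_span_eq K (Set.range M.row)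
  choose g hg using hf
  refine ⟨g, fun j j' hjj' i => ?_⟩
  have hle : Submodule.span K (Set.range f) ≤
      LinearMap.eqLocus (LinearMap.proj j : (Fin m → K) →ₗ[K] K) (LinearMap.proj j') := by
    rw [Submodule.span_le]
    rintro _ ⟨k, rfl⟩
    rw [← hg k]
    exact hjj' k
  have hi : M.row i ∈ Submodule.span K (Set.range f) :=
    hspan.ge (Submodule.subset_span ⟨i, rfl⟩)
  exact hle hi

/-- A `0,1` matrix over a field has at most `2 ^ M.rank` distinct columns. -/
theorem card_image_cols_le_two_pow_rank {K : Type*} [Field K] [DecidableEq K] {n m : ℕ}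
    (M : Matrix (Fin n) (Fin m) K) (hM : ∀ i j, M i j = 0 ∨ M i j = 1) :
    (Finset.univ.image fun j : Fin m => fun i => M i j).card ≤ 2 ^ M.rank := by
  obtain ⟨g, hg⟩ := exists_rows_determining_cols M
  have hcard : (Fintype.piFinset fun _ : Fin M.rank => ({0, 1} : Finset K)).card =
      2 ^ M.rank := by
    simp
  rw [← hcard]
  refine Finset.card_le_card_of_injOn (fun c k => c (g k)) ?_ ?_
  · intro c hc
    obtain ⟨j, -, rfl⟩ := Finset.mem_image.mp hc
    simpa using fun k => hM (g k) j
  · intro c hc c' hc' heq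
    obtain ⟨j, -, rfl⟩ := Finset.mem_image.mp hc
    obtain ⟨j', -, rfl⟩ := Finset.mem_image.mp hc'
    exact funext (hg j j' (congrFun heq))

/-- A `0,1` matrix of real rank at most `d` has at most `2^d` distinct rows and
at most `2^d` distinct columns. -/
theorem distinct_rows_cols_le_of_real_rank {n m : ℕ} (M : Matrix (Fin n) (Fin m) ℚ)
    (hM : ∀ i j, M i j = 0 ∨ M i j = 1) (d : ℕ) (h : M.rank ≤ d) :
    (Finset.univ.image fun i : Fin n => M i).card ≤ 2 ^ d ∧
    (Finset.univ.image fun j : Fin m => fun i => M i j).card ≤ 2 ^ d := by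
  have hpow : 2 ^ M.rank ≤ 2 ^ d := Nat.pow_le_pow_right two_pos h
  refine ⟨le_trans ?_ hpow, (card_image_cols_le_two_pow_rank M hM).trans hpow⟩
  rw [← M.rank_transpose]
  exact card_image_cols_le_two_pow_rank M.transpose fun i j => hM j i
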